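/- Let V be a finite-dimensional real inner product space with inner product g, let J₊ and J₋ be complex structures on V compatible with g, let G : V → V* be x ↦ g(x, ·), and set F₊ = G ∘ J₊, F₋ = G ∘ J₋. Define 𝒥₁, 𝒥₂ : V ⊕ V* → V ⊕ V* by 𝒥₁(X, ξ) = ½((J₊ + J₋)X − (F₊⁻¹ − F₋⁻¹)(ξ), (F₊ − F₋)(X) − ξ ∘ (J₊ + J₋)) and 𝒥₂(X, ξ) = ½((J₊ − J₋)X − (F₊⁻¹ + F₋⁻¹)(ξ), (F₊ + F₋)(X) − ξ ∘ (J₊ − J₋)). Then the quadratic form w ↦ B(𝒥₁ w, 𝒥₂ w) is positive definite on V ⊕ V*, i.e. B(𝒥₁ w, 𝒥₂ w) > 0 for every nonzero w ∈ V ⊕ V*. -/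

import Mathlib

open RealInnerProductSpace

/-- A complex structure compatible with the inner product is skew-adjoint. -/
theorem inner_complexStructure_right {V : Type*} [NormedAddCommGroup V] [InnerProductSpace ℝ V]
    {J : V →ₗ[ℝ] V} (hJ : J ∘ₗ J = -LinearMap.id) (hg : ∀ x y : V, ⟪J x, J y⟫ = ⟪x, y⟫)
    (x y : V) : ⟪x, J y⟫ = -⟪J x, y⟫ := by
  have hJJ : J (J y) = -y := by simpa using LinearMap.congr_fun hJ y
  rw [← hg x (J y), hJJ, inner_neg_right]

theorem injective_of_forall_apply_eq_inner {V : Type*} [NormedAddCommGroup V]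
    [InnerProductSpace ℝ V] {G : V →ₗ[ℝ] Module.Dual ℝ V} (hG : ∀ x y : V, G x y = ⟪x, y⟫) :
    Function.Injective G := fun x y h =>
  ext_inner_right ℝ fun v => by rw [← hG, ← hG, h]

/-- The inverse of `G ∘ J` sends `G y` to `-J y` when `G` is injective and `J ∘ J = -id`. -/
theorem invFun_comp_complexStructure {V W : Type*} [AddCommGroup V] [Module ℝ V]
    [AddCommGroup W] [Module ℝ W] {G : V →ₗ[ℝ] W} (hG : Function.Injective G)
    {J : V →ₗ[ℝ] V} (hJ : J ∘ₗ J = -LinearMap.id) (y : V) :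
    Function.invFun ⇑(G ∘ₗ J) (G y) = -J y := by
  have hJJ (v : V) : J (J v) = -v := by simpa using LinearMap.congr_fun hJ v
  have hinj : Function.Injective ⇑(G ∘ₗ J) := by
    refine hG.comp fun u v h => neg_injective ?_
    rw [← hJJ u, ← hJJ v, h]
  have hy : G y = (G ∘ₗ J) (-J y) := by simp [hJJ]
  rw [hy, Function.leftInverse_invFun hinj]

/-- the quadratic form `w ↦ B(𝒥₁ w, 𝒥₂ w)` associated to the Gualtieri pair
`(𝒥₁, 𝒥₂)` of a bi-Hermitian structure `(g, J₊, J₋)` is positive definite on `V ⊕ V*`. -/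
theorem stmt_8 (V : Type*) [NormedAddCommGroup V] [InnerProductSpace ℝ V]
    [FiniteDimensional ℝ V]
    (Jp Jm : V →ₗ[ℝ] V)
    (hJp : Jp ∘ₗ Jp = -LinearMap.id) (hJm : Jm ∘ₗ Jm = -LinearMap.id)
    (hgp : ∀ x y : V, ⟪Jp x, Jp y⟫ = ⟪x, y⟫)
    (hgm : ∀ x y : V, ⟪Jm x, Jm y⟫ = ⟪x, y⟫)
    (G : V →ₗ[ℝ] Module.Dual ℝ V) (hG : ∀ x y : V, G x y = ⟪x, y⟫)
    (B : V × Module.Dual ℝ V → V × Module.Dual ℝ V → ℝ)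
    (hB : ∀ w z : V × Module.Dual ℝ V, B w z = (w.2 z.1 + z.2 w.1) / 2)
    (J1 J2 : V × Module.Dual ℝ V → V × Module.Dual ℝ V)
    (hJ1 : ∀ (X : V) (ξ : Module.Dual ℝ V),
      J1 (X, ξ) =
        ((1 / 2 : ℝ) • ((Jp + Jm) X -
            (Function.invFun ⇑(G ∘ₗ Jp) ξ - Function.invFun ⇑(G ∘ₗ Jm) ξ)),
         (1 / 2 : ℝ) • (((G ∘ₗ Jp) X - (G ∘ₗ Jm) X) - ξ ∘ₗ (Jp + Jm))))
    (hJ2 : ∀ (X : V) (ξ : Module.Dual ℝ V),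
      J2 (X, ξ) =
        ((1 / 2 : ℝ) • ((Jp - Jm) X -
            (Function.invFun ⇑(G ∘ₗ Jp) ξ + Function.invFun ⇑(G ∘ₗ Jm) ξ)),
         (1 / 2 : ℝ) • (((G ∘ₗ Jp) X + (G ∘ₗ Jm) X) - ξ ∘ₗ (Jp - Jm)))) :
    ∀ w : V × Module.Dual ℝ V, w ≠ 0 → 0 < B (J1 w) (J2 w) := by
  rintro ⟨X, ξ⟩ hw
  have hGinj := injective_of_forall_apply_eq_inner hG
  obtain ⟨y, rfl⟩ : ∃ y, G y = ξ :=
    (LinearMap.injective_iff_surjective_of_finrank_eq_finrank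
      Subspace.dual_finrank_eq.symm).1 hGinj ξ
  have hval : B (J1 (X, G y)) (J2 (X, G y)) = (⟪X, X⟫ + ⟪y, y⟫) / 2 := by
    rw [hB, hJ1, hJ2, invFun_comp_complexStructure hGinj hJp,
      invFun_comp_complexStructure hGinj hJm]
    simp only [LinearMap.smul_apply, LinearMap.sub_apply, LinearMap.add_apply,
      LinearMap.comp_apply, hG, map_smul, map_sub, map_add, map_neg, smul_eq_mul,
      inner_add_right, inner_sub_right, hgp, hgm,
      inner_complexStructure_right hJp hgp y, inner_complexStructure_right hJm hgm y]
    simp only [real_inner_comm (Jp _) (Jm _), real_inner_comm X y]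
    ring
  rw [hval]
  by_cases hX : X = 0
  · have hy : y ≠ 0 := by
      rintro rfl
      exact hw (by simp [hX])
    have := real_inner_self_pos.2 hy
    have := real_inner_self_nonneg (x := X)
    linarith
  · have := real_inner_self_pos.2 hX
    have := real_inner_self_nonneg (x := y)
    linarith
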